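/- arXiv:1011.5193 — 5 statements merged into one kernel-verified Lean document; each statement's English description precedes it below -/
import Mathlib

section
/- For every natural number n ≥ 2 there exists a flexion of the 8n vertices A_i, B_i, C_i, D_i indexed cyclically by i ∈ ZMod (2n), realizing a flexible closed polyhedron of genus 1 with 8n quadrilateral faces, namely: for every i ∈ ZMod (2n) the four quadrilateral faces (A_i,B_i,B_{i+1},A_{i+1}), (B_i,C_i,C_{i+1},B_{i+1}), (C_i,D_i,D_{i+1},C_{i+1}), (D_i,A_i,A_{i+1},D_{i+1}) are rigid, planar and nondegenerate at every parameter t; the flexion is nontrivial; and at some parameter t two faces self-intersect. -/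
noncomputable section

abbrev E : Type := EuclideanSpace ℝ (Fin 3)

/-- The distance between two moving vertices is constant in the flexion parameter. -/
def PreservedDist (p q : ℝ → E) : Prop :=
  ∀ t t' : ℝ, dist (p t) (q t) = dist (p t') (q t')

/-- A triangular face is rigid: all pairwise distances between its vertices are constant. -/
def RigidTri (p q r : ℝ → E) : Prop :=
  PreservedDist p q ∧ PreservedDist q r ∧ PreservedDist p r

/-- A triangular face is nondegenerate at parameter `t`. -/
def NondegTri (p q r : ℝ → E) (t : ℝ) : Prop :=
  p t ≠ q t ∧ q t ≠ r t ∧ p t ≠ r t ∧ ¬ Collinear ℝ ({p t, q t, r t} : Set E)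

/-- A quadrilateral face is rigid: all pairwise distances between its vertices are constant. -/
def RigidQuad (p q r s : ℝ → E) : Prop :=
  PreservedDist p q ∧ PreservedDist p r ∧ PreservedDist p s ∧
  PreservedDist q r ∧ PreservedDist q s ∧ PreservedDist r s

/-- A quadrilateral face is planar (its four vertices are coplanar) at every parameter. -/
def PlanarQuad (p q r s : ℝ → E) : Prop :=
  ∀ t : ℝ, Coplanar ℝ ({p t, q t, r t, s t} : Set E)

/-- A quadrilateral face is nondegenerate at parameter `t`. -/
def NondegQuad (p q r s : ℝ → E) (t : ℝ) : Prop :=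
  p t ≠ q t ∧ p t ≠ r t ∧ p t ≠ s t ∧ q t ≠ r t ∧ q t ≠ s t ∧ r t ≠ s t ∧
  ¬ Collinear ℝ ({p t, q t, r t, s t} : Set E)

/-- Two faces (given by their sets of moving vertices) self-intersect at parameter `t`:
their vertex sets are disjoint and the convex hulls of their vertex positions at `t` meet. -/
def FacesIntersect (F G : Set (ℝ → E)) (t : ℝ) : Prop :=
  Disjoint F G ∧
  ((convexHull ℝ ((fun v => v t) '' F)) ∩ (convexHull ℝ ((fun v => v t) '' G))).Nonempty

/-- The collection of moving vertices of the genus-1 (torus) polyhedron. -/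
def TorusVerts (m : ℕ) (A B C D : ZMod m → ℝ → E) : Set (ℝ → E) :=
  Set.range A ∪ Set.range B ∪ Set.range C ∪ Set.range D

/-- The faces of the torus: for each cyclic index `i` the four band quadrilaterals. -/
def TorusFaces (m : ℕ) (A B C D : ZMod m → ℝ → E) : Set (Set (ℝ → E)) :=
  { F | ∃ i : ZMod m,
      F = ({A i, B i, B (i+1), A (i+1)} : Set (ℝ → E)) ∨
      F = ({B i, C i, C (i+1), B (i+1)} : Set (ℝ → E)) ∨
      F = ({C i, D i, D (i+1), C (i+1)} : Set (ℝ → E)) ∨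
      F = ({D i, A i, A (i+1), D (i+1)} : Set (ℝ → E)) }

/-! The polyhedron is a Minkowski sum of a closed rectilinear `2n`-gon with edge directions
`d₁ t, d₂ t` and a parallelogram with edge directions `u t, w t`, where all four are unit vectors
and `u, w` keep a constant angle with `d₁, d₂`. -/

lemma inner_combo (a d : E) (e x y : ℝ) (ha : inner ℝ a a = 1) (hd : inner ℝ d d = 1)
    (had : inner ℝ a d = e) : ‖x • a + y • d‖ ^ 2 = x ^ 2 + 2 * x * y * e + y ^ 2 := by
  rw [← real_inner_self_eq_norm_sq]
  have hda : inner ℝ d a = e := by rw [real_inner_comm]; exact had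
  simp only [inner_add_left, inner_add_right, inner_smul_left, inner_smul_right, ha, hd, had, hda]
  simp
  ring

lemma combo_const (a d : ℝ → E) (e x y : ℝ) (ha : ∀ t, inner ℝ (a t) (a t) = 1)
    (hd : ∀ t, inner ℝ (d t) (d t) = 1) (had : ∀ t, inner ℝ (a t) (d t) = e)
    (p q : ℝ → E) (h : ∀ t, p t - q t = x • a t + y • d t) : PreservedDist p q := by
  intro t t'
  rw [dist_eq_norm, dist_eq_norm, h, h]
  have h1 := inner_combo (a t) (d t) e x y (ha t) (hd t) (had t)
  have h2 := inner_combo (a t') (d t') e x y (ha t') (hd t') (had t')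
  rw [← h2] at h1
  exact (pow_left_inj₀ (norm_nonneg _) (norm_nonneg _) two_ne_zero).1 h1

lemma combo_ne (a d : E) (e x y : ℝ) (he : e ^ 2 < 1) (ha : inner ℝ a a = 1)
    (hd : inner ℝ d d = 1) (had : inner ℝ a d = e) (p q : E)
    (h : p - q = x • a + y • d) (hxy : x ≠ 0 ∨ y ≠ 0) : p ≠ q := by
  intro hpq
  have h1 := inner_combo a d e x y ha hd had
  rw [← h, hpq, sub_self, norm_zero] at h1
  rcases hxy with hx | hy
  · have : 0 < x ^ 2 := by positivity
    nlinarith [sq_nonneg (x * e + y)]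
  · have : 0 < y ^ 2 := by positivity
    nlinarith [sq_nonneg (y * e + x)]

lemma quad_good (p q r s a d : ℝ → E) (c e : ℝ) (hc : c ≠ 0) (he : e ^ 2 < 1)
    (ha : ∀ t, inner ℝ (a t) (a t) = 1)
    (hd : ∀ t, inner ℝ (d t) (d t) = 1) (had : ∀ t, inner ℝ (a t) (d t) = e)
    (hq : ∀ t, q t = p t + a t) (hr : ∀ t, r t = p t + a t + c • d t)
    (hs : ∀ t, s t = p t + c • d t) :
    RigidQuad p q r s ∧ PlanarQuad p q r s ∧ ∀ t, NondegQuad p q r s t := by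
  have e1 : ∀ t, p t - q t = (-1 : ℝ) • a t + (0 : ℝ) • d t := by
    intro t; rw [hq]; module
  have e2 : ∀ t, p t - r t = (-1 : ℝ) • a t + (-c : ℝ) • d t := by
    intro t; rw [hr]; module
  have e3 : ∀ t, p t - s t = (0 : ℝ) • a t + (-c : ℝ) • d t := by
    intro t; rw [hs]; module
  have e4 : ∀ t, q t - r t = (0 : ℝ) • a t + (-c : ℝ) • d t := by
    intro t; rw [hq, hr]; module
  have e5 : ∀ t, q t - s t = (1 : ℝ) • a t + (-c : ℝ) • d t := by
    intro t; rw [hq, hs]; module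
  have e6 : ∀ t, r t - s t = (1 : ℝ) • a t + (0 : ℝ) • d t := by
    intro t; rw [hr, hs]; module
  have P := fun x y => combo_const a d e x y ha hd had
  have N := fun t x y => combo_ne (a t) (d t) e x y he (ha t) (hd t) (had t)
  refine ⟨⟨P _ _ _ _ e1, P _ _ _ _ e2, P _ _ _ _ e3, P _ _ _ _ e4, P _ _ _ _ e5,
    P _ _ _ _ e6⟩, ?_, ?_⟩
  · intro t
    have hmem : r t ∈ affineSpan ℝ ({q t, p t, s t} : Set E) := by
      have h0 : r t = (1 : ℝ) • (q t -ᵥ p t) +ᵥ s t := by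
        rw [hr, hq, hs]; simp only [vsub_eq_sub, vadd_eq_add]; module
      rw [h0]
      apply AffineSubspace.smul_vsub_vadd_mem
      all_goals exact subset_affineSpan ℝ _ (by simp)
    have := (coplanar_insert_iff_of_mem_affineSpan hmem).2 (coplanar_triple ℝ (q t) (p t) (s t))
    refine this.subset ?_
    intro x hx
    simp only [Set.mem_insert_iff, Set.mem_singleton_iff] at hx ⊢
    tauto
  · intro t
    refine ⟨N t _ _ _ _ (e1 t) (by norm_num), N t _ _ _ _ (e2 t) (by norm_num),
      N t _ _ _ _ (e3 t) (by simp [hc]), N t _ _ _ _ (e4 t) (by simp [hc]),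
      N t _ _ _ _ (e5 t) (by norm_num), N t _ _ _ _ (e6 t) (by norm_num), ?_⟩
    intro hcol
    rw [collinear_iff_of_mem (p₀ := p t) (by simp)] at hcol
    obtain ⟨v, hv⟩ := hcol
    obtain ⟨k, hk⟩ := hv (q t) (by simp)
    obtain ⟨l, hl⟩ := hv (s t) (by simp)
    have hk' : a t = k • v := by
      rw [hq, vadd_eq_add, add_comm] at hk; exact add_right_cancel hk
    have hl' : c • d t = l • v := by
      rw [hs, vadd_eq_add, add_comm] at hl; exact add_right_cancel hl
    have hz : l • a t + (-(k * c)) • d t = 0 := by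
      rw [neg_smul, mul_smul, hl', hk']; module
    have hk0 : k ≠ 0 := by
      rintro rfl
      have := ha t
      rw [hk'] at this
      simp at this
    exact N t l (-(k * c)) (0 : E) 0 (by rw [hz]; simp) (Or.inr (by simp [hk0, hc])) rfl

def qf (t : ℝ) : ℝ := (3 + Real.cos t) / 4
def hf (t : ℝ) : ℝ := 1 / (2 * qf t)
def pf (t : ℝ) : ℝ := √(1 - qf t ^ 2)
def rf (t : ℝ) : ℝ := √(1 - hf t ^ 2)
def uf (t : ℝ) : E := !₂[pf t, 0, qf t]
def wf (t : ℝ) : E := !₂[-pf t, 0, qf t]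
def d1 (t : ℝ) : E := !₂[0, rf t, hf t]
def d2 (t : ℝ) : E := !₂[0, -rf t, hf t]

lemma qf_ge (t : ℝ) : 1 / 2 ≤ qf t := by
  unfold qf; linarith [Real.neg_one_le_cos t]
lemma qf_le (t : ℝ) : qf t ≤ 1 := by
  unfold qf; linarith [Real.cos_le_one t]
lemma qh (t : ℝ) : qf t * hf t = 1 / 2 := by
  have := qf_ge t
  unfold hf; field_simp
lemma hf_pos (t : ℝ) : 0 < hf t := by
  have := qf_ge t
  unfold hf; positivity
lemma hf_le (t : ℝ) : hf t ≤ 1 := by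
  nlinarith [qf_ge t, qh t, hf_pos t]
lemma pf_sq (t : ℝ) : pf t ^ 2 = 1 - qf t ^ 2 :=
  Real.sq_sqrt (by nlinarith [qf_ge t, qf_le t])
lemma rf_sq (t : ℝ) : rf t ^ 2 = 1 - hf t ^ 2 :=
  Real.sq_sqrt (by nlinarith [hf_pos t, hf_le t])

lemma qf_cont : Continuous qf := by unfold qf; fun_prop
lemma hf_cont : Continuous hf := by
  unfold hf
  refine continuous_const.div (continuous_const.mul qf_cont) fun t => ?_
  have := qf_ge t
  positivity
lemma pf_cont : Continuous pf := by
  unfold pf; have := qf_cont; fun_prop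
lemma rf_cont : Continuous rf := by
  unfold rf; have := hf_cont; fun_prop

lemma vec_cont (f g h : ℝ → ℝ) (hf : Continuous f) (hg : Continuous g) (hh : Continuous h) :
    Continuous (fun t => (!₂[f t, g t, h t] : E)) := by
  refine (PiLp.continuous_toLp 2 _).comp (continuous_pi fun i => ?_)
  fin_cases i <;> simpa

lemma uf_cont : Continuous uf := vec_cont _ _ _ pf_cont continuous_const qf_cont
lemma wf_cont : Continuous wf := vec_cont _ _ _ pf_cont.neg continuous_const qf_cont
lemma d1_cont : Continuous d1 := vec_cont _ _ _ continuous_const rf_cont hf_cont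
lemma d2_cont : Continuous d2 := vec_cont _ _ _ continuous_const rf_cont.neg hf_cont

lemma inner3 (a b c x y z : ℝ) :
    inner ℝ (!₂[a, b, c] : E) (!₂[x, y, z] : E) = a * x + b * y + c * z := by
  simp [PiLp.inner_apply, Fin.sum_univ_three]; ring

lemma uu (t : ℝ) : inner ℝ (uf t) (uf t) = 1 := by
  unfold uf; rw [inner3]; nlinarith [pf_sq t]
lemma ww (t : ℝ) : inner ℝ (wf t) (wf t) = 1 := by
  unfold wf; rw [inner3]; nlinarith [pf_sq t]
lemma d11 (t : ℝ) : inner ℝ (d1 t) (d1 t) = 1 := by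
  unfold d1; rw [inner3]; nlinarith [rf_sq t]
lemma d22 (t : ℝ) : inner ℝ (d2 t) (d2 t) = 1 := by
  unfold d2; rw [inner3]; nlinarith [rf_sq t]
lemma ud1 (t : ℝ) : inner ℝ (uf t) (d1 t) = 1 / 2 := by
  unfold uf d1; rw [inner3]; linarith [qh t]
lemma ud2 (t : ℝ) : inner ℝ (uf t) (d2 t) = 1 / 2 := by
  unfold uf d2; rw [inner3]; linarith [qh t]
lemma wd1 (t : ℝ) : inner ℝ (wf t) (d1 t) = 1 / 2 := by
  unfold wf d1; rw [inner3]; linarith [qh t]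
lemma wd2 (t : ℝ) : inner ℝ (wf t) (d2 t) = 1 / 2 := by
  unfold wf d2; rw [inner3]; linarith [qh t]

/-- Coordinates of the closed rectilinear polygon. -/
def xc (n : ℕ) (i : ZMod (2 * n)) : ℕ := ((i.val + 1) / 2) % n
def yc (n : ℕ) (i : ZMod (2 * n)) : ℕ := i.val / 2

lemma val_succ (n : ℕ) (hn : 2 ≤ n) (i : ZMod (2 * n)) :
    (i + 1).val = if i.val + 1 = 2 * n then 0 else i.val + 1 := by
  haveI : NeZero (2 * n) := ⟨by omega⟩
  haveI : Fact (1 < 2 * n) := ⟨by omega⟩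
  have hi := i.val_lt
  rw [ZMod.val_add, ZMod.val_one]
  split_ifs with h
  · rw [h]; simp
  · exact Nat.mod_eq_of_lt (by omega)

lemma step (n : ℕ) (hn : 2 ≤ n) (i : ZMod (2 * n)) :
    (xc n (i + 1) ≠ xc n i ∧ yc n (i + 1) = yc n i) ∨
    (xc n (i + 1) = xc n i ∧ yc n (i + 1) ≠ yc n i) := by
  haveI : NeZero (2 * n) := ⟨by omega⟩
  have hi := i.val_lt
  have hs := val_succ n hn i
  unfold xc yc
  rw [hs]
  generalize i.val = v at *
  split_ifs with h
  · right
    have : (v + 1) / 2 = n := by omega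
    rw [this]
    simp
    omega
  · rcases Nat.even_or_odd' v with ⟨k, rfl | rfl⟩
    · left
      have h1 : (2 * k + 1 + 1) / 2 = k + 1 := by omega
      have h2 : (2 * k + 1) / 2 = k := by omega
      rw [h1, h2, Nat.mod_eq_of_lt (show k < n by omega)]
      refine ⟨?_, by omega⟩
      rcases Nat.lt_or_ge (k + 1) n with h3 | h3
      · rw [Nat.mod_eq_of_lt h3]; omega
      · have : k + 1 = n := by omega
        rw [this, Nat.mod_self]; omega
    · right
      have h1 : (2 * k + 1 + 1 + 1) / 2 = k + 1 := by omega
      have h2 : (2 * k + 1 + 1) / 2 = k + 1 := by omega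
      rw [h1, h2]
      exact ⟨rfl, by omega⟩

def Pf (n : ℕ) (i : ZMod (2 * n)) (t : ℝ) : E := (xc n i : ℝ) • d1 t + (yc n i : ℝ) • d2 t

lemma Pf_cont (n : ℕ) (i : ZMod (2 * n)) : Continuous (Pf n i) := by
  unfold Pf; have := d1_cont; have := d2_cont; fun_prop

lemma edge (n : ℕ) (hn : 2 ≤ n) (i : ZMod (2 * n)) :
    ∃ (c : ℝ) (d : ℝ → E), c ≠ 0 ∧ (∀ t, inner ℝ (d t) (d t) = 1) ∧
      (∀ t, inner ℝ (uf t) (d t) = 1 / 2) ∧ (∀ t, inner ℝ (wf t) (d t) = 1 / 2) ∧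
      ∀ t, Pf n (i + 1) t = Pf n i t + c • d t := by
  rcases step n hn i with ⟨h1, h2⟩ | ⟨h1, h2⟩
  · refine ⟨(xc n (i + 1) : ℝ) - xc n i, d1, ?_, d11, ud1, wd1, ?_⟩
    · rw [sub_ne_zero]; exact_mod_cast h1
    · intro t; unfold Pf; rw [h2]; module
  · refine ⟨(yc n (i + 1) : ℝ) - yc n i, d2, ?_, d22, ud2, wd2, ?_⟩
    · rw [sub_ne_zero]; exact_mod_cast h2
    · intro t; unfold Pf; rw [h1]; module

lemma Pf_zero (n : ℕ) (t : ℝ) : Pf n 0 t = 0 := by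
  simp [Pf, xc, yc]

lemma Pf_one (n : ℕ) (hn : 2 ≤ n) (t : ℝ) : Pf n (0 + 1) t = d1 t := by
  have h := val_succ n hn 0
  rw [ZMod.val_zero, if_neg (by omega)] at h
  unfold Pf xc yc
  rw [h]
  have : 1 % n = 1 := Nat.mod_eq_of_lt (by omega)
  simp [this]

lemma pf_zero : pf 0 = 0 := by simp [pf, qf]; norm_num
lemma pf_half : 0 < pf (Real.pi / 2) := by
  apply Real.sqrt_pos.2; simp [qf]; norm_num
lemma rf_half : 0 < rf (Real.pi / 2) := by
  apply Real.sqrt_pos.2; simp [hf, qf]; norm_num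

lemma face_ne (x y : ℝ → E) (a b c d : ℝ) 
    (hx : ∀ t, x t = a • d1 t + b • uf t) (hy : ∀ t, y t = c • d1 t + d • uf t + wf t) :
    x ≠ y := by
  intro h
  have h1 := congrFun h (Real.pi / 2)
  rw [hx, hy] at h1
  have g0 := congrArg (fun v : E => v 0) h1
  have g1 := congrArg (fun v : E => v 1) h1
  have g2 := congrArg (fun v : E => v 2) h1
  simp [d1, uf, wf] at g0 g1 g2
  have hp := pf_half
  have hr := rf_half
  have hq := qf_ge (Real.pi / 2)
  generalize pf (Real.pi / 2) = p at *
  generalize qf (Real.pi / 2) = q at *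
  have k1 : a = c := by rcases g1 with h | h <;> linarith
  subst k1
  have k0 : b = d - 1 := by
    apply mul_right_cancel₀ hp.ne'; linarith
  subst k0
  linarith

/-- **Theorem 2 of the paper.**  For every `n ≥ 2` there is a flexion of the `8n` vertices
`A i, B i, C i, D i` (indexed cyclically by `i : ZMod (2n)`) realizing a flexible closed
polyhedron of genus 1 with `8n` quadrilateral faces: every band quadrilateral is rigid,
planar and everywhere nondegenerate, the flexion is nontrivial, and at some parameter two
of the faces self-intersect. -/
theorem exists_flexible_genus_one_polyhedron (n : ℕ) (hn : 2 ≤ n) :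
    ∃ A B C D : ZMod (2*n) → ℝ → E,
      ((∀ i, Continuous (A i)) ∧ (∀ i, Continuous (B i)) ∧
       (∀ i, Continuous (C i)) ∧ (∀ i, Continuous (D i))) ∧
      (∀ i : ZMod (2*n),
        (RigidQuad (A i) (B i) (B (i+1)) (A (i+1)) ∧
          PlanarQuad (A i) (B i) (B (i+1)) (A (i+1)) ∧
          (∀ t, NondegQuad (A i) (B i) (B (i+1)) (A (i+1)) t)) ∧
        (RigidQuad (B i) (C i) (C (i+1)) (B (i+1)) ∧
          PlanarQuad (B i) (C i) (C (i+1)) (B (i+1)) ∧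
          (∀ t, NondegQuad (B i) (C i) (C (i+1)) (B (i+1)) t)) ∧
        (RigidQuad (C i) (D i) (D (i+1)) (C (i+1)) ∧
          PlanarQuad (C i) (D i) (D (i+1)) (C (i+1)) ∧
          (∀ t, NondegQuad (C i) (D i) (D (i+1)) (C (i+1)) t)) ∧
        (RigidQuad (D i) (A i) (A (i+1)) (D (i+1)) ∧
          PlanarQuad (D i) (A i) (A (i+1)) (D (i+1)) ∧
          (∀ t, NondegQuad (D i) (A i) (A (i+1)) (D (i+1)) t))) ∧
      (∃ p ∈ TorusVerts (2*n) A B C D, ∃ q ∈ TorusVerts (2*n) A B C D,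
        ∃ t₀ t₁ : ℝ, dist (p t₀) (q t₀) ≠ dist (p t₁) (q t₁)) ∧
      (∃ t : ℝ, ∃ F ∈ TorusFaces (2*n) A B C D, ∃ G ∈ TorusFaces (2*n) A B C D,
        F ≠ G ∧ FacesIntersect F G t) := by
  refine ⟨fun i t => Pf n i t, fun i t => Pf n i t + uf t, fun i t => Pf n i t + uf t + wf t,
    fun i t => Pf n i t + wf t, ⟨fun i => Pf_cont n i, fun i => (Pf_cont n i).add uf_cont,
      fun i => ((Pf_cont n i).add uf_cont).add wf_cont, fun i => (Pf_cont n i).add wf_cont⟩,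
    ?_, ?_, ?_⟩
  · intro i
    obtain ⟨c, d, hc, hd, hu, hw, hP⟩ := edge n hn i
    refine ⟨quad_good _ _ _ _ uf d c (1 / 2) hc (by norm_num) uu hd hu ?_ ?_ ?_,
      quad_good _ _ _ _ wf d c (1 / 2) hc (by norm_num) ww hd hw ?_ ?_ ?_,
      quad_good _ _ _ _ (fun t => - uf t) d c (-(1 / 2)) hc (by norm_num)
        (fun t => by rw [inner_neg_neg]; exact uu t) hd
        (fun t => by rw [inner_neg_left, hu]) ?_ ?_ ?_,
      quad_good _ _ _ _ (fun t => - wf t) d c (-(1 / 2)) hc (by norm_num)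
        (fun t => by rw [inner_neg_neg]; exact ww t) hd
        (fun t => by rw [inner_neg_left, hw]) ?_ ?_ ?_⟩
    all_goals
      intro t
      try simp only [hP]
      try module
  · refine ⟨fun t => Pf n 0 t + uf t, ?_, fun t => Pf n 0 t + wf t, ?_, 0, Real.pi / 2, ?_⟩
    · exact Or.inl (Or.inl (Or.inr ⟨0, rfl⟩))
    · exact Or.inr ⟨0, rfl⟩
    · have h0 : uf 0 = wf 0 := by simp [uf, wf, pf_zero]
      simp only [h0, dist_self]
      intro h
      have h1 := add_left_cancel (dist_eq_zero.1 h.symm)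
      have g0 := congrArg (fun v : E => v 0) h1
      simp [uf, wf] at g0
      linarith [pf_half]
  · have h0 : uf 0 = wf 0 := by simp [uf, wf, pf_zero]
    have hdis : Disjoint
        ({fun t => Pf n 0 t, fun t => Pf n 0 t + uf t, fun t => Pf n (0 + 1) t + uf t,
          fun t => Pf n (0 + 1) t} : Set (ℝ → E))
        ({fun t => Pf n 0 t + uf t + wf t, fun t => Pf n 0 t + wf t,
          fun t => Pf n (0 + 1) t + wf t, fun t => Pf n (0 + 1) t + uf t + wf t} :
            Set (ℝ → E)) := by
      rw [Set.disjoint_left]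
      intro x hx hy
      have kx : ∃ a b : ℝ, ∀ t, x t = a • d1 t + b • uf t := by
        simp only [Pf_zero, Pf_one n hn, Set.mem_insert_iff, Set.mem_singleton_iff] at hx
        rcases hx with rfl | rfl | rfl | rfl
        · exact ⟨0, 0, fun t => by module⟩
        · exact ⟨0, 1, fun t => by module⟩
        · exact ⟨1, 1, fun t => by module⟩
        · exact ⟨1, 0, fun t => by module⟩
      have ky : ∃ a b : ℝ, ∀ t, x t = a • d1 t + b • uf t + wf t := by
        simp only [Pf_zero, Pf_one n hn, Set.mem_insert_iff, Set.mem_singleton_iff] at hy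
        rcases hy with rfl | rfl | rfl | rfl
        · exact ⟨0, 1, fun t => by module⟩
        · exact ⟨0, 0, fun t => by module⟩
        · exact ⟨1, 0, fun t => by module⟩
        · exact ⟨1, 1, fun t => by module⟩
      obtain ⟨a, b, hx⟩ := kx
      obtain ⟨c, d, hy⟩ := ky
      exact face_ne x x a b c d hx hy rfl
    refine ⟨0, _, ⟨0, Or.inl rfl⟩, _, ⟨0, Or.inr (Or.inr (Or.inl rfl))⟩, ?_, hdis, ?_⟩
    · intro h
      rw [← h, disjoint_self] at hdis
      exact (Set.insert_nonempty _ _).ne_empty hdis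
    · refine ⟨Pf n 0 0 + uf 0, subset_convexHull ℝ _ ?_, subset_convexHull ℝ _ ?_⟩
      · exact ⟨fun t => Pf n 0 t + uf t, by simp, rfl⟩
      · exact ⟨fun t => Pf n 0 t + wf t, by simp, by simp [h0]⟩
end
end

section
/- Let x, a, b : ℝ → E be continuous maps such that t ↦ dist (a t) (x t), t ↦ dist (b t) (x t) and t ↦ dist (a t) (b t) are constant functions. Fix a real number s and define a' t = x t + s • (a t − x t) and b' t = x t + s • (b t − x t). Then: (i) dist (a' t) (b' t) = |s| · dist (a t) (b t) for all t, so it is constant; (ii) each of the functions t ↦ dist (a t) (a' t), t ↦ dist (b t) (b' t), t ↦ dist (a t) (b' t) and t ↦ dist (b t) (a' t) is constant; and (iii) for every t the set {x t, a t, b t, a' t, b' t} is coplanar. In particular the quadrilateral with vertices a, b, b', a' is rigid and planar under the flexion. -/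
noncomputable section

/-- The theorem of Stewart, in the form needed here. -/
theorem stewart_aux (x p q : E) (s : ℝ) :
    dist p (x + s • (q - x)) ^ 2 =
      (1 - s) * dist p x ^ 2 + s * dist p q ^ 2 - s * (1 - s) * dist q x ^ 2 := by
  have e1 : p - (x + s • (q - x)) = (p - x) - s • (q - x) := by abel
  have e2 : p - q = (p - x) - (q - x) := by abel
  rw [dist_eq_norm, dist_eq_norm, dist_eq_norm, dist_eq_norm, e1, e2,
    norm_sub_sq_real (p - x) (s • (q - x)), norm_sub_sq_real (p - x) (q - x), inner_smul_right, norm_smul, mul_pow,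
    Real.norm_eq_abs, sq_abs]
  ring

theorem preserved_aux (x p q q' : ℝ → E) (s : ℝ)
    (hpx : ∀ t t' : ℝ, dist (p t) (x t) = dist (p t') (x t'))
    (hqx : ∀ t t' : ℝ, dist (q t) (x t) = dist (q t') (x t'))
    (hpq : ∀ t t' : ℝ, dist (p t) (q t) = dist (p t') (q t'))
    (hq' : ∀ t, q' t = x t + s • (q t - x t)) (t t' : ℝ) :
    dist (p t) (q' t) = dist (p t') (q' t') := by
  rw [← sq_eq_sq₀ dist_nonneg dist_nonneg, hq', hq', stewart_aux, stewart_aux,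
    hpx t t', hqx t t', hpq t t']

theorem coplanar_aux (x a b : E) (s : ℝ) :
    Coplanar ℝ ({x, a, b, x + s • (a - x), x + s • (b - x)} : Set E) := by
  have key : ∀ (S : Set E) (p : E), x ∈ S → p ∈ S → x + s • (p - x) ∈ affineSpan ℝ S := by
    intro S p hx hp
    have h := AffineMap.lineMap_mem s (subset_affineSpan ℝ S hx) (subset_affineSpan ℝ S hp)
    rwa [AffineMap.lineMap_apply, vsub_eq_sub, vadd_eq_add, add_comm] at h
  have h1 := (coplanar_insert_iff_of_mem_affineSpan
    (key {x, a, b} a (by simp) (by simp))).2 (coplanar_triple ℝ x a b)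
  have h2 := (coplanar_insert_iff_of_mem_affineSpan
    (key (insert (x + s • (a - x)) {x, a, b}) b (by simp) (by simp))).2 h1
  refine h2.subset ?_
  intro y hy
  simp only [Set.mem_insert_iff, Set.mem_singleton_iff] at hy ⊢
  tauto

/-- **The scaling lemma behind cap extension.**  If the three mutual distances of the moving
points `x, a, b` are constant and `a', b'` are obtained by scaling the edges `x a`, `x b`
by the fixed factor `s`, then (i) `dist (a' t) (b' t) = |s| * dist (a t) (b t)`, hence is
constant; (ii) the distances `a a'`, `b b'`, `a b'`, `b a'` are constant; and (iii) the five
points are coplanar at every parameter.  In particular the quadrilateral `(a, b, b', a')` is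
rigid and planar under the flexion. -/
theorem scaled_extension_rigid_planar
    (x a b : ℝ → E) (hx : Continuous x) (ha : Continuous a) (hb : Continuous b)
    (hax : ∀ t t' : ℝ, dist (a t) (x t) = dist (a t') (x t'))
    (hbx : ∀ t t' : ℝ, dist (b t) (x t) = dist (b t') (x t'))
    (hab : ∀ t t' : ℝ, dist (a t) (b t) = dist (a t') (b t'))
    (s : ℝ) (a' b' : ℝ → E)
    (ha' : ∀ t, a' t = x t + s • (a t - x t))
    (hb' : ∀ t, b' t = x t + s • (b t - x t)) :
    (∀ t, dist (a' t) (b' t) = |s| * dist (a t) (b t)) ∧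
    (∀ t t' : ℝ, dist (a' t) (b' t) = dist (a' t') (b' t')) ∧
    (∀ t t' : ℝ, dist (a t) (a' t) = dist (a t') (a' t')) ∧
    (∀ t t' : ℝ, dist (b t) (b' t) = dist (b t') (b' t')) ∧
    (∀ t t' : ℝ, dist (a t) (b' t) = dist (a t') (b' t')) ∧
    (∀ t t' : ℝ, dist (b t) (a' t) = dist (b t') (a' t')) ∧
    (∀ t : ℝ, Coplanar ℝ ({x t, a t, b t, a' t, b' t} : Set E)) ∧
    (RigidQuad a b b' a' ∧ PlanarQuad a b b' a') := by
  have h1 : ∀ t, dist (a' t) (b' t) = |s| * dist (a t) (b t) := by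
    intro t
    rw [ha', hb', dist_add_left, dist_smul₀, dist_sub_right, Real.norm_eq_abs]
  have h2 : ∀ t t' : ℝ, dist (a' t) (b' t) = dist (a' t') (b' t') := by
    intro t t'
    rw [h1, h1, hab t t']
  have hba : ∀ t t' : ℝ, dist (b t) (a t) = dist (b t') (a t') := by
    intro t t'
    rw [dist_comm, hab t t', dist_comm]
  have h3 := preserved_aux x a a a' s hax hax (by simp) ha'
  have h4 := preserved_aux x b b b' s hbx hbx (by simp) hb'
  have h5 := preserved_aux x a b b' s hax hbx hab hb'
  have h6 := preserved_aux x b a a' s hbx hax hba ha'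
  have h7 : ∀ t : ℝ, Coplanar ℝ ({x t, a t, b t, a' t, b' t} : Set E) := by
    intro t
    rw [ha', hb']
    exact coplanar_aux _ _ _ _
  refine ⟨h1, h2, h3, h4, h5, h6, h7, ⟨hab, h5, h3, h4, h6, ?_⟩, ?_⟩
  · intro t t'
    rw [dist_comm, h2 t t', dist_comm]
  · intro t
    refine (h7 t).subset ?_
    intro y hy
    simp only [Set.mem_insert_iff, Set.mem_singleton_iff] at hy ⊢
    tauto
end
end

section
/- Let x₀, x₁, a, b, c, d : ℝ → E be continuous maps such that the twelve edge lengths dist (x₀ t) (a t), dist (x₀ t) (b t), dist (x₀ t) (c t), dist (x₀ t) (d t), dist (x₁ t) (a t), dist (x₁ t) (b t), dist (x₁ t) (c t), dist (x₁ t) (d t), dist (a t) (b t), dist (b t) (c t), dist (c t) (d t), dist (d t) (a t) are all constant in t (a flexing octahedron). Fix a real number s and define the extended vertices a' t = x₁ t + s • (a t − x₁ t), b' t = x₁ t + s • (b t − x₁ t), c' t = x₁ t + s • (c t − x₁ t), d' t = x₁ t + s • (d t − x₁ t). Then each of the four quadrilateral faces (a,b,b',a'), (b,c,c',b'), (c,d,d',c'),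 (d,a,a',d') is rigid (all six pairwise distances among its four vertices are constant in t) and planar (its four vertices are coplanar at every t); consequently all faces of the composite open polyhedron consisting of the four cap triangles (x₀,a,b), (x₀,b,c), (x₀,c,d), (x₀,d,a) and these four quadrilaterals are rigid under the flexion. -/
noncomputable section

/-- Combinations of two edge vectors of a rigid triangle have constant length. -/
theorem preservedDist_of_comb (x p q f g : ℝ → E) (α β : ℝ)
    (hp : PreservedDist x p) (hq : PreservedDist x q) (hpq : PreservedDist p q)
    (h : ∀ t, f t - g t = α • (p t - x t) + β • (q t - x t)) : PreservedDist f g := by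
  have key : ∀ t, dist (f t) (g t) ^ 2 = α ^ 2 * dist (x t) (p t) ^ 2 +
      α * β * (dist (x t) (p t) ^ 2 + dist (x t) (q t) ^ 2 - dist (p t) (q t) ^ 2) +
      β ^ 2 * dist (x t) (q t) ^ 2 := by
    intro t
    have e : p t - q t = (p t - x t) - (q t - x t) := by abel
    rw [dist_comm (x t) (p t), dist_comm (x t) (q t)]
    simp only [dist_eq_norm]
    rw [h t, e, norm_add_sq_real, norm_sub_sq_real (p t - x t) (q t - x t), norm_smul, norm_smul,
      real_inner_smul_left, real_inner_smul_right, mul_pow, mul_pow]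
    simp only [Real.norm_eq_abs, sq_abs]
    ring
  intro t t'
  have h2 : dist (f t) (g t) ^ 2 = dist (f t') (g t') ^ 2 := by
    rw [key t, key t', hp t t', hq t t', hpq t t']
  exact (pow_left_inj₀ dist_nonneg dist_nonneg two_ne_zero).1 h2

/-- The quadrilateral obtained by extending two edges of a rigid triangle is rigid and planar. -/
theorem quad_rigid_planar (x p q p' q' : ℝ → E) (s : ℝ)
    (hp : PreservedDist x p) (hq : PreservedDist x q) (hpq : PreservedDist p q)
    (hp' : ∀ t, p' t = x t + s • (p t - x t)) (hq' : ∀ t, q' t = x t + s • (q t - x t)) :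
    RigidQuad p q q' p' ∧ PlanarQuad p q q' p' := by
  refine ⟨⟨hpq, ?_, ?_, ?_, ?_, ?_⟩, ?_⟩
  · exact preservedDist_of_comb x p q _ _ 1 (-s) hp hq hpq (fun t => by rw [hq']; module)
  · exact preservedDist_of_comb x p q _ _ (1 - s) 0 hp hq hpq (fun t => by rw [hp']; module)
  · exact preservedDist_of_comb x p q _ _ 0 (1 - s) hp hq hpq (fun t => by rw [hq']; module)
  · exact preservedDist_of_comb x p q _ _ (-s) 1 hp hq hpq (fun t => by rw [hp']; module)
  · exact preservedDist_of_comb x p q _ _ (-s) s hp hq hpq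
      (fun t => by rw [hp', hq']; module)
  · intro t
    have mem : ∀ (S : Set E) (r : E), x t ∈ S → r ∈ S →
        x t + s • (r - x t) ∈ affineSpan ℝ S := by
      intro S r hx hr
      have := AffineMap.lineMap_mem s (subset_affineSpan ℝ S hx) (subset_affineSpan ℝ S hr)
      rwa [AffineMap.lineMap_apply, vsub_eq_sub, vadd_eq_add, add_comm] at this
    have h1 : Coplanar ℝ ({x t, p t, q t} : Set E) := coplanar_triple ℝ _ _ _
    have h2 : Coplanar ℝ (insert (q' t) ({x t, p t, q t} : Set E)) :=
      (coplanar_insert_iff_of_mem_affineSpan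
        (by rw [hq']; exact mem _ _ (by simp) (by simp))).2 h1
    have h3 : Coplanar ℝ (insert (p' t) (insert (q' t) ({x t, p t, q t} : Set E))) :=
      (coplanar_insert_iff_of_mem_affineSpan
        (by rw [hp']; exact mem _ _ (by simp) (by simp))).2 h2
    refine h3.subset ?_
    intro y hy
    simp only [Set.mem_insert_iff, Set.mem_singleton_iff] at hy ⊢
    tauto

/-- **The inductive step of the recursive construction.**  Extending the edges at the vertex
`x₁` of a flexing octahedron by a fixed scale factor `s` produces four quadrilateral faces
that are rigid and planar; together with the four rigid cap triangles at `x₀` they form a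
composite flexible open octahedral surface. -/
theorem octahedron_extension_rigid
    (x₀ x₁ a b c d : ℝ → E)
    (hx₀ : Continuous x₀) (hx₁ : Continuous x₁) (ha : Continuous a) (hb : Continuous b)
    (hc : Continuous c) (hd : Continuous d)
    (h₀a : PreservedDist x₀ a) (h₀b : PreservedDist x₀ b)
    (h₀c : PreservedDist x₀ c) (h₀d : PreservedDist x₀ d)
    (h₁a : PreservedDist x₁ a) (h₁b : PreservedDist x₁ b)
    (h₁c : PreservedDist x₁ c) (h₁d : PreservedDist x₁ d)
    (hab : PreservedDist a b) (hbc : PreservedDist b c)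
    (hcd : PreservedDist c d) (hda : PreservedDist d a)
    (s : ℝ) (a' b' c' d' : ℝ → E)
    (ha' : ∀ t, a' t = x₁ t + s • (a t - x₁ t))
    (hb' : ∀ t, b' t = x₁ t + s • (b t - x₁ t))
    (hc' : ∀ t, c' t = x₁ t + s • (c t - x₁ t))
    (hd' : ∀ t, d' t = x₁ t + s • (d t - x₁ t)) :
    (RigidQuad a b b' a' ∧ PlanarQuad a b b' a') ∧
    (RigidQuad b c c' b' ∧ PlanarQuad b c c' b') ∧
    (RigidQuad c d d' c' ∧ PlanarQuad c d d' c') ∧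
    (RigidQuad d a a' d' ∧ PlanarQuad d a a' d') ∧
    (RigidTri x₀ a b ∧ RigidTri x₀ b c ∧ RigidTri x₀ c d ∧ RigidTri x₀ d a) := by
  exact ⟨quad_rigid_planar x₁ a b a' b' s h₁a h₁b hab ha' hb',
    quad_rigid_planar x₁ b c b' c' s h₁b h₁c hbc hb' hc',
    quad_rigid_planar x₁ c d c' d' s h₁c h₁d hcd hc' hd',
    quad_rigid_planar x₁ d a d' a' s h₁d h₁a hda hd' ha',
    ⟨h₀a, hab, h₀b⟩, ⟨h₀b, hbc, h₀c⟩, ⟨h₀c, hcd, h₀d⟩, ⟨h₀d, hda, h₀a⟩⟩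
end
end

section
/- Let θ, φ ∈ (0, π) be real numbers and let a, b, k be real numbers. If cot (φ/2) = k · tan (θ/2) and cot φ = a · cot θ + b, then (k + a) · (cot (φ/2))² − 2·b·k · cot (φ/2) − k·(1 + a·k) = 0. -/
noncomputable section

open Real

/-- **Equation (3a) of the paper.**  Combining the law-of-sines relation
`cot φ = a * cot θ + b` (Eq. 1) with the alternative Bricard half-angle relation
`cot (φ/2) = k * tan (θ/2)` (Eq. 2a) yields the quadratic equation
`(k + a) * cot²(φ/2) - 2bk * cot (φ/2) - k (1 + a k) = 0`. -/
theorem bricard_half_angle_quadratic_alt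
    (θ φ a b k : ℝ) (hθ : θ ∈ Set.Ioo 0 π) (hφ : φ ∈ Set.Ioo 0 π)
    (h2a : Real.cot (φ / 2) = k * Real.tan (θ / 2))
    (h1 : Real.cot φ = a * Real.cot θ + b) :
    (k + a) * (Real.cot (φ / 2)) ^ 2 - 2 * b * k * Real.cot (φ / 2) - k * (1 + a * k) = 0 := by
  obtain ⟨hθ0, hθ1⟩ := hθ
  obtain ⟨hφ0, hφ1⟩ := hφ
  have hx : 2 * Real.cot (φ / 2) * Real.cot φ = Real.cot (φ / 2) ^ 2 - 1 := by
    have s : Real.sin (φ / 2) ≠ 0 := (Real.sin_pos_of_pos_of_lt_pi (by linarith) (by linarith)).ne'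
    have c : Real.cos (φ / 2) ≠ 0 := (Real.cos_pos_of_mem_Ioo ⟨by linarith, by linarith⟩).ne'
    have e : φ = 2 * (φ / 2) := by ring
    have h : Real.cot φ = (Real.cos (φ / 2) ^ 2 - Real.sin (φ / 2) ^ 2) /
        (2 * Real.sin (φ / 2) * Real.cos (φ / 2)) := by
      conv_lhs => rw [e, Real.cot_eq_cos_div_sin, Real.cos_two_mul', Real.sin_two_mul]
    rw [h, Real.cot_eq_cos_div_sin]
    field_simp
  have ht : 2 * Real.tan (θ / 2) * Real.cot θ = 1 - Real.tan (θ / 2) ^ 2 := by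
    have s : Real.sin (θ / 2) ≠ 0 := (Real.sin_pos_of_pos_of_lt_pi (by linarith) (by linarith)).ne'
    have c : Real.cos (θ / 2) ≠ 0 := (Real.cos_pos_of_mem_Ioo ⟨by linarith, by linarith⟩).ne'
    have e : θ = 2 * (θ / 2) := by ring
    have h : Real.cot θ = (Real.cos (θ / 2) ^ 2 - Real.sin (θ / 2) ^ 2) /
        (2 * Real.sin (θ / 2) * Real.cos (θ / 2)) := by
      conv_lhs => rw [e, Real.cot_eq_cos_div_sin, Real.cos_two_mul', Real.sin_two_mul]
    rw [h, Real.tan_eq_sin_div_cos]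
    field_simp
  rw [h1, h2a] at hx
  rw [h2a]
  linear_combination (-k) * hx + a * k ^ 2 * ht
end
end

section
/- There exists a flexion of 6 vertices x₀, x₁, a, b, c, d realizing a flexible octahedron: the twelve edges x₀–a, x₀–b, x₀–c, x₀–d, x₁–a, x₁–b, x₁–c, x₁–d, a–b, b–c, c–d, d–a are preserved; each of the eight triangular faces (x₀,a,b), (x₀,b,c), (x₀,c,d), (x₀,d,a), (x₁,a,b), (x₁,b,c), (x₁,c,d), (x₁,d,a) is nondegenerate at every parameter t; the flexion is nontrivial; and there exist parameters t₀ ≠ t₁ such that all six vertices are coplanar at t₀ and all six vertices are coplanar at t₁, while some pairwise distance between vertices is nonconstant on the interval between t₀ and t₁ (the octahedron passes through two distinct flat positions). -/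
noncomputable section

/-! ### The construction

The octahedron is plane-symmetric: `a, c` and `b, d` are mirror images in the plane `X = 0`, which
contains `x₀ = 0` and `x₁ = (0, w, 0)`.  The diagonal `w = |x₀ x₁|` oscillates between `3` and `4`,
and the octahedron is flat exactly at these two values. -/

namespace Octa

def w (t : ℝ) : ℝ := 7 / 2 + Real.sin t / 2
def g (t : ℝ) : ℝ := √((w t ^ 2 - 1) / (w t ^ 2 - 4))
def h (t : ℝ) : ℝ := Real.cos t * √((w t + 3) * (w t + 4)) / (4 * w t)
def k : ℝ := √15 / 2 * √30
def p (t : ℝ) : ℝ := √15 / 2 * g t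
def q (t : ℝ) : ℝ := √30 / g t
def y₁ (t : ℝ) : ℝ := (6 + w t ^ 2) / (2 * w t)
def y₂ (t : ℝ) : ℝ := (24 + w t ^ 2) / (2 * w t)
def z₁ (t : ℝ) : ℝ := h t * g t
def z₂ (t : ℝ) : ℝ := h t / g t

lemma w_ge (t : ℝ) : 3 ≤ w t := by
  unfold w; linarith [Real.neg_one_le_sin t]

lemma den_pos (t : ℝ) : 0 < w t ^ 2 - 4 := by nlinarith [w_ge t]

lemma num_pos (t : ℝ) : 0 < w t ^ 2 - 1 := by nlinarith [w_ge t]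

lemma g_pos (t : ℝ) : 0 < g t := Real.sqrt_pos.2 (div_pos (num_pos t) (den_pos t))

lemma g_sq (t : ℝ) : g t ^ 2 = (w t ^ 2 - 1) / (w t ^ 2 - 4) :=
  Real.sq_sqrt (div_pos (num_pos t) (den_pos t)).le

lemma cos_sq (t : ℝ) : Real.cos t ^ 2 = 4 * ((w t - 3) * (4 - w t)) := by
  unfold w; nlinarith [Real.sin_sq_add_cos_sq t]

lemma h_sq (t : ℝ) : h t ^ 2 = (w t ^ 2 - 9) * (16 - w t ^ 2) / (4 * w t ^ 2) := by
  have hw := w_ge t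
  unfold h
  rw [div_pow, mul_pow, Real.sq_sqrt (by positivity), cos_sq]
  field_simp
  ring

lemma s15 : √(15 : ℝ) ^ 2 = 15 := Real.sq_sqrt (by norm_num)
lemma s30 : √(30 : ℝ) ^ 2 = 30 := Real.sq_sqrt (by norm_num)

lemma k_sq : k ^ 2 = 225 / 2 := by
  unfold k; rw [mul_pow, div_pow, s15, s30]; norm_num

lemma R1 (t : ℝ) : p t ^ 2 + y₁ t ^ 2 + z₁ t ^ 2 = 49 / 4 := by
  have hw := w_ge t
  have h1 := (den_pos t).ne'
  unfold p y₁ z₁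
  rw [mul_pow, mul_pow, div_pow, div_pow, s15, g_sq, h_sq]
  field_simp
  ring

lemma R2 (t : ℝ) : q t ^ 2 + y₂ t ^ 2 + z₂ t ^ 2 = 49 := by
  have hw := w_ge t
  have h1 := (den_pos t).ne'
  have h2 := (num_pos t).ne'
  unfold q y₂ z₂
  rw [div_pow, div_pow, div_pow, s30, g_sq, h_sq]
  field_simp
  ring

lemma R3 (t : ℝ) : p t * q t = k := by
  have := (g_pos t).ne'
  unfold p q k; field_simp

lemma R4 (t : ℝ) : y₁ t * y₂ t + z₁ t * z₂ t = 55 / 4 := by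
  have hw := w_ge t
  have := (g_pos t).ne'
  have e : z₁ t * z₂ t = h t ^ 2 := by unfold z₁ z₂; field_simp
  rw [e, h_sq]
  unfold y₁ y₂
  field_simp
  ring

lemma R5 (t : ℝ) : 2 * w t * y₁ t = 6 + w t ^ 2 := by
  have hw := w_ge t
  unfold y₁; field_simp

lemma R6 (t : ℝ) : 2 * w t * y₂ t = 24 + w t ^ 2 := by
  have hw := w_ge t
  unfold y₂; field_simp

lemma w_cont : Continuous w := by unfold w; fun_prop

lemma g_cont : Continuous g := by
  unfold g
  exact ((w_cont.pow 2).sub continuous_const |>.div ((w_cont.pow 2).sub continuous_const)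
    fun t => (den_pos t).ne').sqrt

lemma h_cont : Continuous h := by
  unfold h
  have := w_cont
  refine Continuous.div (by fun_prop) (by fun_prop) fun t => ?_
  have := w_ge t
  positivity

lemma p_cont : Continuous p := by unfold p; exact continuous_const.mul g_cont
lemma q_cont : Continuous q := by
  unfold q; exact continuous_const.div g_cont fun t => (g_pos t).ne'
lemma y₁_cont : Continuous y₁ := by
  unfold y₁
  have := w_cont
  refine Continuous.div (by fun_prop) (by fun_prop) fun t => ?_
  have := w_ge t
  positivity
lemma y₂_cont : Continuous y₂ := by
  unfold y₂
  have := w_cont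
  refine Continuous.div (by fun_prop) (by fun_prop) fun t => ?_
  have := w_ge t
  positivity
lemma z₁_cont : Continuous z₁ := by unfold z₁; exact h_cont.mul g_cont
lemma z₂_cont : Continuous z₂ := by
  unfold z₂; exact h_cont.div g_cont fun t => (g_pos t).ne'

/-- The six vertices. -/
def X0 (_ : ℝ) : E := !₂[0, 0, 0]
def X1 (t : ℝ) : E := !₂[0, w t, 0]
def A (t : ℝ) : E := !₂[p t, y₁ t, z₁ t]
def B (t : ℝ) : E := !₂[q t, y₂ t, z₂ t]
def C (t : ℝ) : E := !₂[-p t, y₁ t, z₁ t]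
def D (t : ℝ) : E := !₂[-q t, y₂ t, z₂ t]

lemma cont_mk {f₁ f₂ f₃ : ℝ → ℝ} (h₁ : Continuous f₁) (h₂ : Continuous f₂) (h₃ : Continuous f₃) :
    Continuous (fun t => (!₂[f₁ t, f₂ t, f₃ t] : E)) := by
  refine (PiLp.continuous_toLp 2 _).comp (continuous_pi fun i => ?_)
  fin_cases i
  · exact h₁
  · exact h₂
  · exact h₃

lemma dist_mk (a b c a' b' c' : ℝ) :
    dist (!₂[a, b, c] : E) !₂[a', b', c'] = √((a - a') ^ 2 + (b - b') ^ 2 + (c - c') ^ 2) := by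
  rw [EuclideanSpace.dist_eq]
  simp [Fin.sum_univ_three, Real.dist_eq, sq_abs]

lemma preserved_of {u v : ℝ → E} (r : ℝ) (H : ∀ t, dist (u t) (v t) = √r) :
    PreservedDist u v := fun t t' => by rw [H, H]

/-- Nondegeneracy from the strict Cauchy-Schwarz inequality. -/
lemma nondeg_of {u v x : ℝ → E} {t : ℝ}
    (H : (inner ℝ (v t - u t) (x t - u t)) ^ 2 ≠
      inner ℝ (v t - u t) (v t - u t) * inner ℝ (x t - u t) (x t - u t)) :
    NondegTri u v x t := by
  have hc : ¬ Collinear ℝ ({u t, v t, x t} : Set E) := by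
    intro hcol
    rw [collinear_iff_of_mem (p₀ := u t) (by simp)] at hcol
    obtain ⟨e, he⟩ := hcol
    obtain ⟨α, hα⟩ := he (v t) (by simp)
    obtain ⟨β, hβ⟩ := he (x t) (by simp)
    have e1 : v t - u t = α • e := by rw [hα]; simp
    have e2 : x t - u t = β • e := by rw [hβ]; simp
    apply H
    rw [e1, e2]
    simp only [inner_smul_left, inner_smul_right, conj_trivial]
    ring
  exact ⟨ne₁₂_of_not_collinear hc, ne₂₃_of_not_collinear hc, ne₁₃_of_not_collinear hc, hc⟩

lemma inner_mk (u v x : E) : inner ℝ (v - u) (x - u) =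
    (v 0 - u 0) * (x 0 - u 0) + (v 1 - u 1) * (x 1 - u 1) + (v 2 - u 2) * (x 2 - u 2) := by
  simp [PiLp.inner_apply, Fin.sum_univ_three]
  ring

lemma nondeg_of' {u v x : ℝ → E} {t : ℝ} (i j l : ℝ) (H : i ^ 2 ≠ j * l)
    (hi : (v t 0 - u t 0) * (x t 0 - u t 0) + (v t 1 - u t 1) * (x t 1 - u t 1)
      + (v t 2 - u t 2) * (x t 2 - u t 2) = i)
    (hj : (v t 0 - u t 0) * (v t 0 - u t 0) + (v t 1 - u t 1) * (v t 1 - u t 1)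
      + (v t 2 - u t 2) * (v t 2 - u t 2) = j)
    (hl : (x t 0 - u t 0) * (x t 0 - u t 0) + (x t 1 - u t 1) * (x t 1 - u t 1)
      + (x t 2 - u t 2) * (x t 2 - u t 2) = l) :
    NondegTri u v x t := by
  apply nondeg_of
  rwa [inner_mk, inner_mk, inner_mk, hi, hj, hl]

lemma coplanar_of {s : Set E} (H : ∀ x ∈ s, x 2 = 0) : Coplanar ℝ s := by
  have hle : vectorSpan ℝ s ≤ Submodule.span ℝ
      (({!₂[1, 0, 0], !₂[0, 1, 0]} : Finset E) : Set E) := by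
    rw [vectorSpan_def, Submodule.span_le]
    rintro _ ⟨x, hx, y, hy, rfl⟩
    have e : x -ᵥ y = (x 0 - y 0) • (!₂[1, 0, 0] : E) + (x 1 - y 1) • (!₂[0, 1, 0] : E) := by
      ext i
      fin_cases i
      · simp
      · simp
      · simp [H x hx, H y hy]
    simp only [e]
    refine Submodule.add_mem _ (Submodule.smul_mem _ _ (Submodule.subset_span (by simp)))
      (Submodule.smul_mem _ _ (Submodule.subset_span (by simp)))
  refine (Submodule.rank_mono hle).trans ((rank_span_finset_le _).trans ?_)
  exact_mod_cast Finset.card_le_two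

lemma k_ne (c : ℝ) (hc : c ^ 2 ≠ 225 / 2) : k ≠ c := by
  rintro rfl; exact hc k_sq

lemma ne_a : (55 / 4 + k) ^ 2 ≠ 49 / 4 * 49 := by
  intro e
  exact k_ne ((49 / 4 * 49 - (55 / 4) ^ 2 - 225 / 2) * 2 / 55) (by norm_num)
    (by linarith [k_sq, e])

lemma ne_b : (55 / 4 - k) ^ 2 ≠ 49 / 4 * 49 := by
  intro e
  exact k_ne (-(49 / 4 * 49 - (55 / 4) ^ 2 - 225 / 2) * 2 / 55) (by norm_num)
    (by linarith [k_sq, e])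

lemma ne_c : (-5 / 4 + k) ^ 2 ≠ 25 / 4 * 25 := by
  intro e
  exact k_ne (-(25 / 4 * 25 - (5 / 4) ^ 2 - 225 / 2) * 2 / 5) (by norm_num)
    (by linarith [k_sq, e])

lemma ne_d : (-5 / 4 - k) ^ 2 ≠ 25 / 4 * 25 := by
  intro e
  exact k_ne ((25 / 4 * 25 - (5 / 4) ^ 2 - 225 / 2) * 2 / 5) (by norm_num)
    (by linarith [k_sq, e])

lemma flat_of {t : ℝ} (ht : Real.cos t = 0) :
    Coplanar ℝ ({X0 t, X1 t, A t, B t, C t, D t} : Set E) := by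
  apply coplanar_of
  have hh : h t = 0 := by simp [h, ht]
  have h1 : z₁ t = 0 := by simp [z₁, hh]
  have h2 : z₂ t = 0 := by simp [z₂, hh]
  simp [X0, X1, A, B, C, D, h1, h2]

lemma dist_X (t : ℝ) : dist (X0 t) (X1 t) = w t := by
  have := w_ge t
  rw [X0, X1, dist_mk]
  rw [show ((0 : ℝ) - 0) ^ 2 + (0 - w t) ^ 2 + (0 - 0) ^ 2 = w t ^ 2 by ring,
    Real.sqrt_sq (by linarith)]

end Octa

/-- **A Bricard octahedron of the third type.**  There is a flexion of six vertices whose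
twelve edges are preserved, whose eight triangular faces are everywhere nondegenerate, whose
flexion is nontrivial, and which passes through two distinct flat (all-vertices-coplanar)
positions. -/
theorem exists_flexible_octahedron_two_flat_positions :
    ∃ x₀ x₁ a b c d : ℝ → E,
      (Continuous x₀ ∧ Continuous x₁ ∧ Continuous a ∧ Continuous b ∧
        Continuous c ∧ Continuous d) ∧
      -- the twelve preserved edges
      (PreservedDist x₀ a ∧ PreservedDist x₀ b ∧ PreservedDist x₀ c ∧ PreservedDist x₀ d ∧
       PreservedDist x₁ a ∧ PreservedDist x₁ b ∧ PreservedDist x₁ c ∧ PreservedDist x₁ d ∧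
       PreservedDist a b ∧ PreservedDist b c ∧ PreservedDist c d ∧ PreservedDist d a) ∧
      -- the eight faces are nondegenerate at every parameter
      (∀ t : ℝ,
        NondegTri x₀ a b t ∧ NondegTri x₀ b c t ∧ NondegTri x₀ c d t ∧ NondegTri x₀ d a t ∧
        NondegTri x₁ a b t ∧ NondegTri x₁ b c t ∧ NondegTri x₁ c d t ∧ NondegTri x₁ d a t) ∧
      -- the flexion is nontrivial
      (∃ p ∈ ({x₀, x₁, a, b, c, d} : Set (ℝ → E)),
       ∃ q ∈ ({x₀, x₁, a, b, c, d} : Set (ℝ → E)),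
       ∃ t₀ t₁ : ℝ, dist (p t₀) (q t₀) ≠ dist (p t₁) (q t₁)) ∧
      -- two distinct flat positions
      (∃ t₀ t₁ : ℝ, t₀ ≠ t₁ ∧
        Coplanar ℝ ({x₀ t₀, x₁ t₀, a t₀, b t₀, c t₀, d t₀} : Set E) ∧
        Coplanar ℝ ({x₀ t₁, x₁ t₁, a t₁, b t₁, c t₁, d t₁} : Set E) ∧
        (∃ p ∈ ({x₀, x₁, a, b, c, d} : Set (ℝ → E)),
         ∃ q ∈ ({x₀, x₁, a, b, c, d} : Set (ℝ → E)),
         ∃ s₀ ∈ Set.uIcc t₀ t₁, ∃ s₁ ∈ Set.uIcc t₀ t₁,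
           dist (p s₀) (q s₀) ≠ dist (p s₁) (q s₁))) := by
  open Octa in
  have key : dist (X0 (-(Real.pi / 2))) (X1 (-(Real.pi / 2))) ≠
      dist (X0 (Real.pi / 2)) (X1 (Real.pi / 2)) := by
    rw [dist_X, dist_X, w, w, Real.sin_neg, Real.sin_pi_div_two]; norm_num
  open Octa in
  refine ⟨X0, X1, A, B, C, D,
    ⟨cont_mk continuous_const continuous_const continuous_const,
      cont_mk continuous_const w_cont continuous_const,
      cont_mk p_cont y₁_cont z₁_cont, cont_mk q_cont y₂_cont z₂_cont,
      cont_mk p_cont.neg y₁_cont z₁_cont, cont_mk q_cont.neg y₂_cont z₂_cont⟩,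
    ⟨preserved_of (49/4) fun t => by
      rw [X0, A, dist_mk]; congr 1; linarith [R1 t, R2 t, R3 t, R4 t, R5 t, R6 t],
     preserved_of (49) fun t => by
      rw [X0, B, dist_mk]; congr 1; linarith [R1 t, R2 t, R3 t, R4 t, R5 t, R6 t],
     preserved_of (49/4) fun t => by
      rw [X0, C, dist_mk]; congr 1; linarith [R1 t, R2 t, R3 t, R4 t, R5 t, R6 t],
     preserved_of (49) fun t => by
      rw [X0, D, dist_mk]; congr 1; linarith [R1 t, R2 t, R3 t, R4 t, R5 t, R6 t],
     preserved_of (25/4) fun t => by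
      rw [X1, A, dist_mk]; congr 1; linarith [R1 t, R2 t, R3 t, R4 t, R5 t, R6 t],
     preserved_of (25) fun t => by
      rw [X1, B, dist_mk]; congr 1; linarith [R1 t, R2 t, R3 t, R4 t, R5 t, R6 t],
     preserved_of (25/4) fun t => by
      rw [X1, C, dist_mk]; congr 1; linarith [R1 t, R2 t, R3 t, R4 t, R5 t, R6 t],
     preserved_of (25) fun t => by
      rw [X1, D, dist_mk]; congr 1; linarith [R1 t, R2 t, R3 t, R4 t, R5 t, R6 t],
     preserved_of (135/4 - 2*k) fun t => by
      rw [A, B, dist_mk]; congr 1; linarith [R1 t, R2 t, R3 t, R4 t, R5 t, R6 t],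
     preserved_of (135/4 + 2*k) fun t => by
      rw [B, C, dist_mk]; congr 1; linarith [R1 t, R2 t, R3 t, R4 t, R5 t, R6 t],
     preserved_of (135/4 - 2*k) fun t => by
      rw [C, D, dist_mk]; congr 1; linarith [R1 t, R2 t, R3 t, R4 t, R5 t, R6 t],
     preserved_of (135/4 + 2*k) fun t => by
      rw [D, A, dist_mk]; congr 1; linarith [R1 t, R2 t, R3 t, R4 t, R5 t, R6 t]⟩,
    fun t => ⟨nondeg_of' (55/4 + k) (49/4) (49) ne_a
        (by simp [X0, A, B]; linarith [R1 t, R2 t, R3 t, R4 t, R5 t, R6 t])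
        (by simp [X0, A]; linarith [R1 t, R2 t, R3 t, R4 t, R5 t, R6 t])
        (by simp [X0, B]; linarith [R1 t, R2 t, R3 t, R4 t, R5 t, R6 t]),
      nondeg_of' (55/4 - k) (49) (49/4) (by rw [mul_comm]; exact ne_b)
        (by simp [X0, B, C]; linarith [R1 t, R2 t, R3 t, R4 t, R5 t, R6 t])
        (by simp [X0, B]; linarith [R1 t, R2 t, R3 t, R4 t, R5 t, R6 t])
        (by simp [X0, C]; linarith [R1 t, R2 t, R3 t, R4 t, R5 t, R6 t]),
      nondeg_of' (55/4 + k) (49/4) (49) ne_a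
        (by simp [X0, C, D]; linarith [R1 t, R2 t, R3 t, R4 t, R5 t, R6 t])
        (by simp [X0, C]; linarith [R1 t, R2 t, R3 t, R4 t, R5 t, R6 t])
        (by simp [X0, D]; linarith [R1 t, R2 t, R3 t, R4 t, R5 t, R6 t]),
      nondeg_of' (55/4 - k) (49) (49/4) (by rw [mul_comm]; exact ne_b)
        (by simp [X0, D, A]; linarith [R1 t, R2 t, R3 t, R4 t, R5 t, R6 t])
        (by simp [X0, D]; linarith [R1 t, R2 t, R3 t, R4 t, R5 t, R6 t])
        (by simp [X0, A]; linarith [R1 t, R2 t, R3 t, R4 t, R5 t, R6 t]),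
      nondeg_of' (-5/4 + k) (25/4) (25) ne_c
        (by simp [X1, A, B]; linarith [R1 t, R2 t, R3 t, R4 t, R5 t, R6 t])
        (by simp [X1, A]; linarith [R1 t, R2 t, R3 t, R4 t, R5 t, R6 t])
        (by simp [X1, B]; linarith [R1 t, R2 t, R3 t, R4 t, R5 t, R6 t]),
      nondeg_of' (-5/4 - k) (25) (25/4) (by rw [mul_comm]; exact ne_d)
        (by simp [X1, B, C]; linarith [R1 t, R2 t, R3 t, R4 t, R5 t, R6 t])
        (by simp [X1, B]; linarith [R1 t, R2 t, R3 t, R4 t, R5 t, R6 t])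
        (by simp [X1, C]; linarith [R1 t, R2 t, R3 t, R4 t, R5 t, R6 t]),
      nondeg_of' (-5/4 + k) (25/4) (25) ne_c
        (by simp [X1, C, D]; linarith [R1 t, R2 t, R3 t, R4 t, R5 t, R6 t])
        (by simp [X1, C]; linarith [R1 t, R2 t, R3 t, R4 t, R5 t, R6 t])
        (by simp [X1, D]; linarith [R1 t, R2 t, R3 t, R4 t, R5 t, R6 t]),
      nondeg_of' (-5/4 - k) (25) (25/4) (by rw [mul_comm]; exact ne_d)
        (by simp [X1, D, A]; linarith [R1 t, R2 t, R3 t, R4 t, R5 t, R6 t])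
        (by simp [X1, D]; linarith [R1 t, R2 t, R3 t, R4 t, R5 t, R6 t])
        (by simp [X1, A]; linarith [R1 t, R2 t, R3 t, R4 t, R5 t, R6 t])⟩,
    ⟨X0, by simp, X1, by simp, -(Real.pi / 2), Real.pi / 2, key⟩,
    ⟨-(Real.pi / 2), Real.pi / 2, by linarith [Real.pi_pos],
      flat_of (by rw [Real.cos_neg, Real.cos_pi_div_two]), flat_of Real.cos_pi_div_two,
      X0, by simp, X1, by simp, _, Set.left_mem_uIcc, _, Set.right_mem_uIcc, key⟩⟩
end
end
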